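/- There is no element $z \in \mathbb{Q}(i, \sqrt{5})$ whose relative norm to $\mathbb{Q}(i)$ equals $i$, i.e., $N_{\mathbb{Q}(i,\sqrt{5})/\mathbb{Q}(i)}(z) \ne i$ for all $z \in \mathbb{Q}(i,\sqrt{5})$. -/

import Mathlib

/-- Reduction of the Gaussian integers modulo the prime `2 + i`, which sends `i` to `3`. -/
def gaussianIntModFive : GaussianInt →+* ZMod 5 :=
  Zsqrtd.lift ⟨3, by decide⟩

lemma two_add_I_dvd_of_gaussianIntModFive_eq_zero {w : GaussianInt}
    (h : gaussianIntModFive w = 0) : (⟨2, 1⟩ : GaussianInt) ∣ w := by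
  have h5 : (5 : ℤ) ∣ w.re + w.im * 3 := by
    apply (ZMod.intCast_zmod_eq_zero_iff_dvd _ 5).mp
    push_cast
    simpa [gaussianIntModFive] using h
  obtain ⟨k, hk⟩ := h5
  refine ⟨⟨2 * k - w.im, w.im - k⟩, ?_⟩
  ext <;> simp [Zsqrtd.re_mul, Zsqrtd.im_mul] <;> linarith

/-- Infinite descent at the prime `2 + i` for the form `x² - 5y² - iz²`. -/
lemma gaussianInt_eq_zero_of_sq_sub_five_mul_sq_eq (x y z : GaussianInt)
    (h : x ^ 2 - 5 * y ^ 2 = ⟨0, 1⟩ * z ^ 2) : z = 0 := by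
  induction hn : z.norm.natAbs using Nat.strong_induction_on generalizing x y z with
  | _ n ih =>
    set π : GaussianInt := ⟨2, 1⟩
    have hπ0 : π ≠ 0 := by decide
    have h5 : (5 : GaussianInt) = π * ⟨2, -1⟩ := by decide
    have hmod := congrArg gaussianIntModFive h
    have hI : gaussianIntModFive ⟨0, 1⟩ = 3 := by decide
    have hfive : (5 : ZMod 5) = 0 := by decide
    have hπc : gaussianIntModFive ⟨2, -1⟩ = 4 := by decide
    have hπm : gaussianIntModFive π = 0 := by decide
    simp only [map_sub, map_mul, map_pow, map_ofNat, hI, hfive, zero_mul, sub_zero] at hmod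
    have key : ∀ u w : ZMod 5, u ^ 2 = 3 * w ^ 2 → u = 0 ∧ w = 0 := by decide
    obtain ⟨hx, hz⟩ := key _ _ hmod
    obtain ⟨x', rfl⟩ := two_add_I_dvd_of_gaussianIntModFive_eq_zero hx
    obtain ⟨z', rfl⟩ := two_add_I_dvd_of_gaussianIntModFive_eq_zero hz
    have h1 : ⟨2, -1⟩ * y ^ 2 = π * (x' ^ 2 - ⟨0, 1⟩ * z' ^ 2) := by
      apply mul_left_cancel₀ hπ0
      rw [h5] at h
      linear_combination -h
    have hy : gaussianIntModFive y = 0 := by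
      have h2 := congrArg gaussianIntModFive h1
      rw [map_mul, map_mul, map_pow, hπc, hπm, zero_mul] at h2
      have : ∀ u : ZMod 5, 4 * u ^ 2 = 0 → u = 0 := by decide
      exact this _ h2
    obtain ⟨y', rfl⟩ := two_add_I_dvd_of_gaussianIntModFive_eq_zero hy
    have h3 : x' ^ 2 - 5 * y' ^ 2 = ⟨0, 1⟩ * z' ^ 2 := by
      apply mul_left_cancel₀ (pow_ne_zero 2 hπ0)
      linear_combination h
    by_contra hne
    have hz' : z' ≠ 0 := right_ne_zero_of_mul hne
    refine hz' (ih _ ?_ x' y' z' h3 rfl)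
    have hπn : π.norm.natAbs = 5 := by decide
    have hpos : 0 < z'.norm.natAbs := by
      rw [Int.natAbs_pos]
      exact fun h0 => hz' (GaussianInt.norm_eq_zero.mp h0)
    rw [← hn, Zsqrtd.norm_mul, Int.natAbs_mul, hπn]
    omega

/-- `i` is not a relative norm of the extension `ℚ(i,√5)/ℚ(i)`:
there are no Gaussian rationals `a, b` with `a² - 5b² = i`. -/
theorem i_not_norm_golden :
    ¬ ∃ a b : ℂ, (∃ p q : ℚ, a = (p : ℂ) + (q : ℂ) * Complex.I) ∧
      (∃ p q : ℚ, b = (p : ℂ) + (q : ℂ) * Complex.I) ∧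
      a ^ 2 - 5 * b ^ 2 = Complex.I := by
  rintro ⟨a, b, ⟨p, q, rfl⟩, ⟨r, s, rfl⟩, h⟩
  have hden : ∀ t : ℚ, (t : ℂ) * (t.den : ℂ) = (t.num : ℂ) := fun t => by
    exact_mod_cast t.mul_den_eq_num
  have hN : ((p.den * q.den * r.den * s.den : ℕ) : GaussianInt) ≠ 0 := by
    exact_mod_cast (by simp : p.den * q.den * r.den * s.den ≠ 0)
  refine hN (gaussianInt_eq_zero_of_sq_sub_five_mul_sq_eq
    ⟨p.num * q.den * r.den * s.den, q.num * p.den * r.den * s.den⟩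
    ⟨r.num * p.den * q.den * s.den, s.num * p.den * q.den * r.den⟩ _ ?_)
  apply GaussianInt.toComplex_injective
  simp only [map_sub, map_mul, map_pow, map_ofNat, map_natCast, GaussianInt.toComplex_def']
  push_cast
  rw [← hden p, ← hden q, ← hden r, ← hden s]
  linear_combination ((p.den : ℂ) * q.den * r.den * s.den) ^ 2 * h
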